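/- Let A be the weighted adjacency matrix of an undirected weighted graph without loops, D the diagonal matrix of row sums of A, and L = D − A the graph Laplacian. Let S₁, …, S_p be pairwise disjoint subsets of vertices, with |S_t| = m_t ≥ 2, such that each S_t carries an (m_t,k_t,s_t)-star with central weight a_t and weight w_t, and suppose w_t + a_t = λ for all t. Then λ is an eigenvalue of L and the eigenspace ker(L − λ·I) has dimension at least Σ_{t=1}^{p} (m_t − 1). -/

import Mathlib

/-- If two vertices are joined with weight `a`, have the same strength `w`, and are joined to every
other vertex with equal weights, then the difference of their indicator vectors is an eigenvector
of the Laplacian for the eigenvalue `w + a`. -/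
theorem laplacian_mulVec_single_sub_single {V : Type*} [Fintype V] [DecidableEq V]
    {A : Matrix V V ℝ} (hsymm : A.IsSymm) (hdiag : ∀ i, A i i = 0) {i r : V} (hir : i ≠ r)
    {w a : ℝ} (ha : A i r = a) (hout : ∀ l, l ≠ i → l ≠ r → A i l = A r l)
    (hi : ∑ l, A i l = w) (hr : ∑ l, A r l = w) :
    (Matrix.diagonal (fun i => ∑ j, A i j) - A).mulVec (Pi.single i 1 - Pi.single r 1) =
      (w + a) • (Pi.single i 1 - Pi.single r 1 : V → ℝ) := by
  have ha' : A r i = a := by rw [← hsymm.apply r i, ha]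
  ext k
  rw [Matrix.mulVec_sub, Matrix.mulVec_single_one, Matrix.mulVec_single_one]
  simp only [Pi.sub_apply, Matrix.col_apply, Matrix.sub_apply, Pi.smul_apply, smul_eq_mul]
  by_cases hki : k = i
  · subst hki
    simp [hir, hdiag, hi, ha]
  by_cases hkr : k = r
  · subst hkr
    simp [hki, hdiag, hr, ha']
    ring
  · have h := hout k hki hkr
    rw [← hsymm.apply k i, ← hsymm.apply k r]
    simp [hki, hkr, h]

/-- Differences of indicator vectors `e_x - e_{r t}`, where `x` runs over `S t` without the chosen
root `r t`, are linearly independent when the sets `S t` are pairwise disjoint. -/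
theorem linearIndependent_single_sub_single {V ι : Type*} [DecidableEq V] [Fintype ι]
    {S : ι → Finset V} (hdisj : ∀ t t', t ≠ t' → Disjoint (S t) (S t'))
    {r : ι → V} (hr : ∀ t, r t ∈ S t) :
    LinearIndependent ℝ (fun x : (t : ι) × ((S t).erase (r t)) =>
      (Pi.single x.2.1 1 - Pi.single (r x.1) 1 : V → ℝ)) := by
  classical
  have hidx : ∀ t t' x, x ∈ S t → x ∈ S t' → t = t' := fun t t' x h h' => by
    by_contra hne
    exact Finset.disjoint_left.mp (hdisj t t' hne) h h'
  rw [Fintype.linearIndependent_iff]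
  rintro g hg ⟨t, x, hx⟩
  obtain ⟨hxr, hxS⟩ := Finset.mem_erase.mp hx
  have h := congrFun hg x
  rw [Finset.sum_apply, Finset.sum_eq_single ⟨t, x, hx⟩] at h
  · simpa [hxr] using h
  · rintro ⟨t', y, hy⟩ - hne
    have hroot : x ≠ r t' := by
      rintro rfl
      obtain rfl := hidx t t' _ hxS (hr t')
      exact hxr rfl
    have hxy : x ≠ y := by
      rintro rfl
      obtain rfl := hidx t t' _ hxS (Finset.mem_of_mem_erase hy)
      exact hne rfl
    simp [hroot, hxy]
  · simp


/-- If pairwise disjoint subsets `S t` (each of size `m t ≥ 2`) of a loopless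
weighted graph each carry an `(m_t,k_t,s_t)`-star with central weight `a t` and weight `w t`,
and `w t + a t = lam` for all `t`, then `lam` is an eigenvalue of the Laplacian `L = D - A`
with eigenspace of dimension at least `∑ (m t - 1)`. -/
theorem stmt_2 {n p : ℕ} (hp : 0 < p) (A : Matrix (Fin n) (Fin n) ℝ)
    (hsymm : A.IsSymm)
    (hnonneg : ∀ i j, 0 ≤ A i j)
    (hdiag : ∀ i, A i i = 0)
    (D L : Matrix (Fin n) (Fin n) ℝ)
    (hD : D = Matrix.diagonal (fun i => ∑ j, A i j))
    (hL : L = D - A)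
    (S : Fin p → Finset (Fin n)) (m : Fin p → ℕ)
    (hm : ∀ t, 2 ≤ m t) (hcard : ∀ t, (S t).card = m t)
    (hdisj : ∀ t t', t ≠ t' → Disjoint (S t) (S t'))
    (a w : Fin p → ℝ) (ha : ∀ t, 0 ≤ a t)
    (hstar_center : ∀ t, ∀ i ∈ S t, ∀ j ∈ S t, i ≠ j → A i j = a t)
    (hstar_out : ∀ t, ∀ i ∈ S t, ∀ j ∈ S t, ∀ l, l ∉ S t → A i l = A j l)
    (hw : ∀ t, ∀ i ∈ S t, ∑ l, A i l = w t)
    (lam : ℝ) (hlam : ∀ t, w t + a t = lam) :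
    Module.End.HasEigenvalue (Matrix.toLin' L) lam ∧
    (∑ t, (m t - 1)) ≤
      Module.finrank ℝ (Module.End.eigenspace (Matrix.toLin' L) lam) := by
  have hne : ∀ t, (S t).Nonempty := fun t => by
    rw [← Finset.card_pos, hcard]
    exact lt_of_lt_of_le two_pos (hm t)
  choose r hr using hne
  have hmem : ∀ x : (t : Fin p) × ((S t).erase (r t)),
      (Pi.single x.2.1 1 - Pi.single (r x.1) 1 : Fin n → ℝ) ∈
        Module.End.eigenspace (Matrix.toLin' L) lam := by
    rintro ⟨t, x, hx⟩
    obtain ⟨hxr, hxS⟩ := Finset.mem_erase.mp hx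
    rw [Module.End.mem_eigenspace_iff, Matrix.toLin'_apply, hL, hD, ← hlam t]
    refine laplacian_mulVec_single_sub_single hsymm hdiag hxr
      (hstar_center t x hxS _ (hr t) hxr) (fun l hlx hlr => ?_) (hw t x hxS) (hw t _ (hr t))
    by_cases hl : l ∈ S t
    · rw [hstar_center t x hxS l hl hlx.symm, hstar_center t _ (hr t) l hl hlr.symm]
    · exact hstar_out t x hxS _ (hr t) l hl
  have hindep : LinearIndependent ℝ (fun x => (⟨_, hmem x⟩ :
      Module.End.eigenspace (Matrix.toLin' L) lam)) :=
    LinearIndependent.of_comp (Submodule.subtype _) (linearIndependent_single_sub_single hdisj hr)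
  have hdim : (∑ t, (m t - 1)) ≤
      Module.finrank ℝ (Module.End.eigenspace (Matrix.toLin' L) lam) := by
    simpa only [Fintype.card_sigma, Fintype.card_coe, Finset.card_erase_of_mem (hr _), hcard]
      using hindep.fintype_card_le_finrank
  refine ⟨?_, hdim⟩
  have hpos : 0 < ∑ t, (m t - 1) :=
    Finset.sum_pos (fun t _ => Nat.sub_pos_of_lt (hm t)) ⟨⟨0, hp⟩, Finset.mem_univ _⟩
  rw [Module.End.hasEigenvalue_iff, ← Submodule.one_le_finrank_iff]
  exact hpos.trans_le hdim
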